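/- arXiv:2302.01088 — 2 statements merged into one kernel-verified Lean document; each statement's English description precedes it below -/
import Mathlib

section
/- Let φ, ψ > 0 and let H be a Borel probability measure on ℝ whose support is contained in an interval [C₀, C₁] with 0 < C₀ ≤ C₁. Then for every z < 0 there exists a unique real number c(z) < 0 satisfying the equation c(z) = ∫ (z + c(z))·x/(−z − c(z) + x·ψφ⁻¹) dH(x). -/
open MeasureTheory

lemma integrable_div_add_mul {k C₀ C₁ t : ℝ} (hk : 0 < k) (hC₀ : 0 < C₀) (ht : 0 < t)
    (H : Measure ℝ) [IsProbabilityMeasure H] (hsupp : ∀ᵐ x ∂H, x ∈ Set.Icc C₀ C₁) :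
    Integrable (fun x => x / (t + x * k)) H := by
  refine Integrable.of_bound (C := 1 / k) (Measurable.aestronglyMeasurable (by fun_prop)) ?_
  filter_upwards [hsupp] with x hx
  have hx0 : 0 < x := hC₀.trans_le hx.1
  rw [Real.norm_of_nonneg (by positivity), div_le_div_iff₀ (by positivity) hk]
  linarith

lemma continuousOn_integral_div_add_mul {k C₀ C₁ : ℝ} (hk : 0 < k) (hC₀ : 0 < C₀)
    (H : Measure ℝ) [IsProbabilityMeasure H] (hsupp : ∀ᵐ x ∂H, x ∈ Set.Icc C₀ C₁) :
    ContinuousOn (fun t => ∫ x, x / (t + x * k) ∂H) (Set.Ioi 0) := by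
  refine continuousOn_of_dominated (bound := fun _ => 1 / k) ?_ ?_ (integrable_const _) ?_
  · intro t _
    exact Measurable.aestronglyMeasurable (by fun_prop)
  · intro t ht
    have ht : 0 < t := ht
    filter_upwards [hsupp] with x hx
    have hx0 : 0 < x := hC₀.trans_le hx.1
    rw [Real.norm_of_nonneg (by positivity), div_le_div_iff₀ (by positivity) hk]
    linarith
  · filter_upwards [hsupp] with x hx
    have hx0 : 0 < x := hC₀.trans_le hx.1
    refine ContinuousOn.div (by fun_prop) (by fun_prop) fun t ht => ?_
    have ht : 0 < t := ht
    positivity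

lemma integral_div_add_mul_anti {k C₀ C₁ t t' : ℝ} (hk : 0 < k) (hC₀ : 0 < C₀) (ht : 0 < t)
    (htt' : t ≤ t') (H : Measure ℝ) [IsProbabilityMeasure H]
    (hsupp : ∀ᵐ x ∂H, x ∈ Set.Icc C₀ C₁) :
    ∫ x, x / (t' + x * k) ∂H ≤ ∫ x, x / (t + x * k) ∂H := by
  refine integral_mono_ae (integrable_div_add_mul hk hC₀ (ht.trans_le htt') H hsupp)
    (integrable_div_add_mul hk hC₀ ht H hsupp) ?_
  filter_upwards [hsupp] with x hx
  have hx0 : 0 < x := hC₀.trans_le hx.1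
  gcongr

lemma integral_div_add_mul_pos {k C₀ C₁ t : ℝ} (hk : 0 < k) (hC₀ : 0 < C₀) (ht : 0 < t)
    (H : Measure ℝ) [IsProbabilityMeasure H] (hsupp : ∀ᵐ x ∂H, x ∈ Set.Icc C₀ C₁) :
    0 < ∫ x, x / (t + x * k) ∂H := by
  have h : ∫ _, C₀ / (t + C₀ * k) ∂H ≤ ∫ x, x / (t + x * k) ∂H := by
    refine integral_mono_ae (integrable_const _) (integrable_div_add_mul hk hC₀ ht H hsupp) ?_
    filter_upwards [hsupp] with x hx
    have hx0 : 0 < x := hC₀.trans_le hx.1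
    rw [div_le_div_iff₀ (by positivity) (by positivity)]
    nlinarith [mul_le_mul_of_nonneg_right hx.1 ht.le]
  rw [integral_const, probReal_univ, one_smul] at h
  exact lt_of_lt_of_le (by positivity) h

lemma mul_integral_div_add_mul_le {k C₀ C₁ t : ℝ} (hk : 0 < k) (hC₀ : 0 < C₀) (ht : 0 < t)
    (H : Measure ℝ) [IsProbabilityMeasure H] (hsupp : ∀ᵐ x ∂H, x ∈ Set.Icc C₀ C₁) :
    t * ∫ x, x / (t + x * k) ∂H ≤ C₁ := by
  have h : ∫ x, x / (t + x * k) ∂H ≤ ∫ _, C₁ / t ∂H := by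
    refine integral_mono_ae (integrable_div_add_mul hk hC₀ ht H hsupp) (integrable_const _) ?_
    filter_upwards [hsupp] with x hx
    have hx0 : 0 < x := hC₀.trans_le hx.1
    have hC₁ : x ≤ C₁ := hx.2
    exact div_le_div₀ (hx0.le.trans hC₁) hC₁ ht (by nlinarith [mul_pos hx0 hk])
  rw [integral_const, probReal_univ, one_smul, le_div_iff₀ ht] at h
  linarith

/-- For every `z < 0` there is a unique negative solution `c(z)` of the equation
`c(z) = ∫ (z + c(z)) x / (-z - c(z) + x ψ φ⁻¹) dH(x)`. -/
theorem unique_negative_solution_z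
    (φ ψ C₀ C₁ : ℝ) (hφ : 0 < φ) (hψ : 0 < ψ)
    (hC₀ : 0 < C₀) (hC : C₀ ≤ C₁)
    (H : Measure ℝ) [IsProbabilityMeasure H]
    (hsupp : H (Set.Icc C₀ C₁)ᶜ = 0) :
    ∀ z : ℝ, z < 0 →
      ∃! c : ℝ, c < 0 ∧ c = ∫ x, (z + c) * x / (-z - c + x * (ψ * φ⁻¹)) ∂H := by
  intro z hz
  have hk : 0 < ψ * φ⁻¹ := by positivity
  generalize ψ * φ⁻¹ = k at hk
  have hae : ∀ᵐ x ∂H, x ∈ Set.Icc C₀ C₁ := hsupp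
  simp only [mul_div_assoc, integral_const_mul]
  have hcont := continuousOn_integral_div_add_mul hk hC₀ H hae
  have hpos := fun t (ht : 0 < t) => integral_div_add_mul_pos hk hC₀ ht H hae
  have hle := fun t (ht : 0 < t) => mul_integral_div_add_mul_le hk hC₀ ht H hae
  have hanti := fun t t' (ht : 0 < t) (h : t ≤ t') => integral_div_add_mul_anti hk hC₀ ht h H hae
  set g : ℝ → ℝ := fun t => ∫ x, x / (t + x * k) ∂H with hg
  change ∃! c : ℝ, c < 0 ∧ c = (z + c) * g (-z - c)
  refine existsUnique_of_exists_of_unique ?_ ?_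
  · have hcont' : ContinuousOn (fun c => c - (z + c) * g (-z - c)) (Set.Icc (-C₁) 0) := by
      refine continuousOn_id.sub (ContinuousOn.mul (by fun_prop) ?_)
      refine hcont.comp (by fun_prop) fun c hc => ?_
      have := hc.2
      simp only [Set.mem_Ioi]
      linarith
    have h₀ : 0 < 0 - (z + 0) * g (-z - 0) := by
      have := mul_pos_of_neg_of_neg hz (neg_lt_zero.2 (hpos (-z - 0) (by linarith)))
      simp only [hg] at this ⊢
      linarith
    have h₁ : -C₁ - (z + -C₁) * g (-z - -C₁) ≤ 0 := by
      have := hle (-z - -C₁) (by linarith)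
      simp only [hg] at this ⊢
      linarith
    obtain ⟨c, hc, hc0⟩ := intermediate_value_Icc (by linarith) hcont' ⟨h₁, h₀.le⟩
    refine ⟨c, lt_of_le_of_ne hc.2 ?_, sub_eq_zero.1 hc0⟩
    rintro rfl
    exact h₀.ne' hc0
  · have key : ∀ a b : ℝ, a < 0 → b < 0 → a = (z + a) * g (-z - a) →
        b = (z + b) * g (-z - b) → a ≤ b := by
      intro a b ha hb hab hbb
      by_contra! hlt
      have hmono : g (-z - b) ≤ g (-z - a) := hanti (-z - a) (-z - b) (by linarith) (by linarith)
      have h : b * (z + a) ≤ a * (z + b) := by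
        calc b * (z + a) = (z + a) * (z + b) * g (-z - b) := by linear_combination (z + a) * hbb
          _ ≤ (z + a) * (z + b) * g (-z - a) :=
            mul_le_mul_of_nonneg_left hmono
              (mul_nonneg_of_nonpos_of_nonpos (by linarith) (by linarith))
          _ = a * (z + b) := by linear_combination -(z + b) * hab
      nlinarith [mul_pos_of_neg_of_neg hz (sub_neg.2 hlt)]
    rintro a b ⟨ha, hab⟩ ⟨hb, hbb⟩
    exact le_antisymm (key a b ha hb hab hbb) (key b a hb ha hbb hab)
end

section
/- Let φ, ψ > 0 with φψ⁻¹ < 1, let B be a Borel probability measure on ℝ whose support is contained in an interval [C̃₀, C̃₁] with 0 < C̃₀ ≤ C̃₁, and let c̃₀ < 0 be the unique negative solution of 1 = ψ ∫ x/(−c̃₀ + x·φ) dB(x). Then 0 < ψ ∫ x²φ/(c̃₀ − xφ)² dB(x) < 1, so that the limiting variance formula σ²·J/(1 − J), with J this quantity, is well defined and positive. -/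
open MeasureTheory

/-- The integral of an almost everywhere positive integrable function with respect to a
probability measure is positive. -/
lemma integral_pos_of_ae_pos {α : Type*} [MeasurableSpace α] {μ : Measure α}
    [IsProbabilityMeasure μ] {f : α → ℝ} (hf : Integrable f μ) (hpos : ∀ᵐ x ∂μ, 0 < f x) :
    0 < ∫ x, f x ∂μ := by
  rw [integral_pos_iff_support_of_nonneg_ae (hpos.mono fun _ hx => hx.le) hf]
  have hsupp : ∀ᵐ x ∂μ, x ∈ Function.support f := hpos.mono fun _ hx => hx.ne'
  rw [measure_congr (Filter.eventuallyEq_univ.mpr hsupp : Function.support f =ᵐ[μ] Set.univ)]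
  simp

/-- In the underparameterized regime, with `c̃₀` the unique negative solution of the
self-consistent equation, the quantity `J = ψ ∫ x²φ/(c̃₀ - xφ)² dB(x)` lies strictly between
0 and 1, so the limiting variance `σ² J/(1-J)` is well defined and positive. -/
theorem under_variance_integral_bounds
    (φ ψ C₀ C₁ : ℝ) (hφ : 0 < φ) (hψ : 0 < ψ) (hratio : φ * ψ⁻¹ < 1)
    (hC₀ : 0 < C₀) (hC : C₀ ≤ C₁)
    (B : Measure ℝ) [IsProbabilityMeasure B]
    (hsupp : B (Set.Icc C₀ C₁)ᶜ = 0)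
    (c₀ : ℝ) (hc₀neg : c₀ < 0)
    (hc₀ : 1 = ψ * ∫ x, x / (-c₀ + x * φ) ∂B) :
    0 < ψ * ∫ x, x ^ 2 * φ / (c₀ - x * φ) ^ 2 ∂B ∧
      (ψ * ∫ x, x ^ 2 * φ / (c₀ - x * φ) ^ 2 ∂B) < 1 := by
  have hx_pos : ∀ᵐ x ∂B, 0 < x := by
    have hmem : ∀ᵐ x ∂B, x ∈ Set.Icc C₀ C₁ := hsupp
    exact hmem.mono fun x hx => hC₀.trans_le hx.1
  have hg : Integrable (fun x : ℝ => x / (-c₀ + x * φ)) B := by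
    by_contra h
    rw [integral_undef h] at hc₀
    norm_num at hc₀
  have hf_pos : ∀ᵐ x ∂B, 0 < x ^ 2 * φ / (c₀ - x * φ) ^ 2 := by
    filter_upwards [hx_pos] with x hx
    have hden : c₀ - x * φ < 0 := by nlinarith [mul_pos hx hφ]
    have := pow_pos (neg_pos.mpr hden) 2
    rw [neg_sq] at this
    positivity
  have hfg : ∀ᵐ x ∂B, x ^ 2 * φ / (c₀ - x * φ) ^ 2 < x / (-c₀ + x * φ) := by
    filter_upwards [hx_pos] with x hx
    have hden : 0 < -c₀ + x * φ := by nlinarith [mul_pos hx hφ]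
    rw [show (c₀ - x * φ) ^ 2 = (-c₀ + x * φ) ^ 2 by ring,
      div_lt_div_iff₀ (pow_pos hden 2) hden]
    have := mul_pos (mul_pos hx hden) (neg_pos.mpr hc₀neg)
    linarith
  have hf : Integrable (fun x : ℝ => x ^ 2 * φ / (c₀ - x * φ) ^ 2) B := by
    refine hg.mono' (Measurable.aestronglyMeasurable (by fun_prop)) ?_
    filter_upwards [hf_pos, hfg] with x h₀ h₁
    rw [Real.norm_of_nonneg h₀.le]
    exact h₁.le
  refine ⟨mul_pos hψ (integral_pos_of_ae_pos hf hf_pos), ?_⟩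
  have hsub := integral_pos_of_ae_pos (hg.sub hf) (hfg.mono fun x hx => sub_pos.mpr hx)
  simp only [Pi.sub_apply] at hsub
  rw [integral_sub hg hf, sub_pos] at hsub
  rw [hc₀]
  exact mul_lt_mul_of_pos_left hsub hψ
end
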